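/- Define A_{3,N,s} = Π_{i=1}^{N} (2(i−1)+s)/(2i). Then, as s and N tend to infinity jointly with s odd (i.e., for every ε > 0 there is M such that for all odd s ≥ M and all N ≥ M), the ratio of A_{3,N,s} to (1 + (s−1)/(2N))^N · (1 + 2N/(s−1))^{(s−1)/2} · (2πN)^{−1/2} lies within [1−ε, 1+ε]. -/

import Mathlib

open Filter Topology Stirling in
theorem tendsto_stirlingSeq_two_mul_div :
    Tendsto (fun k : ℕ => stirlingSeq (2 * k) / stirlingSeq k) atTop (𝓝 1) := by
  have hpi : √Real.pi ≠ 0 := (Real.sqrt_pos.2 Real.pi_pos).ne'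
  have h2 : Tendsto (fun k : ℕ => 2 * k) atTop atTop :=
    tendsto_id.const_mul_atTop' two_pos
  have h := (tendsto_stirlingSeq_sqrt_pi.comp h2).div tendsto_stirlingSeq_sqrt_pi hpi
  rwa [div_self hpi] at h

theorem stirlingSeq_pos {n : ℕ} (hn : n ≠ 0) : 0 < Stirling.stirlingSeq n :=
  (Real.sqrt_pos.2 Real.pi_pos).trans_le (Stirling.sqrt_pi_le_stirlingSeq hn)

theorem factorial_eq_stirlingSeq_mul {n : ℕ} (hn : n ≠ 0) :
    (n.factorial : ℝ) = Stirling.stirlingSeq n * (√(2 * n) * (n / Real.exp 1) ^ n) := by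
  have : (0 : ℝ) < n := by positivity
  rw [Stirling.stirlingSeq, div_mul_cancel₀]
  positivity

theorem factorial_two_mul_div_factorial {k : ℕ} (hk : k ≠ 0) :
    ((2 * k).factorial : ℝ) / k.factorial =
      √2 * (Stirling.stirlingSeq (2 * k) / Stirling.stirlingSeq k) *
        (4 ^ k * (k / Real.exp 1) ^ k) := by
  have hk' : (0 : ℝ) < k := by positivity
  have hσ := stirlingSeq_pos hk
  have hsqrt : √(2 * ((2 * k : ℕ) : ℝ)) = √2 * √(2 * k) := by
    push_cast
    exact Real.sqrt_mul zero_le_two _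
  have hpow : (((2 * k : ℕ) : ℝ) / Real.exp 1) ^ (2 * k) =
      4 ^ k * (k / Real.exp 1) ^ k * (k / Real.exp 1) ^ k := by
    rw [pow_mul, ← mul_pow, ← mul_pow]
    congr 1
    push_cast
    ring
  rw [factorial_eq_stirlingSeq_mul hk,
    factorial_eq_stirlingSeq_mul (show 2 * k ≠ 0 by omega), hsqrt, hpow]
  have : √(2 * (k : ℝ)) ≠ 0 := by positivity
  field_simp

theorem prod_two_mul_add_odd_div (m N : ℕ) :
    ∏ i ∈ Finset.range N, (2 * (i : ℝ) + (2 * m + 1 : ℕ)) / (2 * (i : ℝ) + 2) =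
      ((2 * (N + m)).factorial : ℝ) / (N + m).factorial /
        (((2 * m).factorial : ℝ) / m.factorial) / (4 ^ N * N.factorial) := by
  induction N with
  | zero =>
    have h₁ : ((2 * m).factorial : ℝ) ≠ 0 := by positivity
    have h₂ : (m.factorial : ℝ) ≠ 0 := by positivity
    simp [h₁, h₂]
  | succ N ih =>
    rw [Finset.prod_range_succ, ih, show 2 * (N + 1 + m) = 2 * (N + m) + 1 + 1 by ring,
      show N + 1 + m = N + m + 1 by ring]
    simp only [Nat.factorial_succ, pow_succ]
    push_cast
    field_simp
    ring

theorem prod_div_eq_stirlingSeq {m N : ℕ} (hm : m ≠ 0) (hN : N ≠ 0) :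
    (∏ i ∈ Finset.range N, (2 * (i : ℝ) + (2 * m + 1 : ℕ)) / (2 * (i : ℝ) + 2)) /
        ((1 + (m : ℝ) / N) ^ N * (1 + (N : ℝ) / m) ^ m * (√(2 * Real.pi * N))⁻¹) =
      Stirling.stirlingSeq (2 * (N + m)) / Stirling.stirlingSeq (N + m) /
        (Stirling.stirlingSeq (2 * m) / Stirling.stirlingSeq m) *
          (√Real.pi / Stirling.stirlingSeq N) := by
  have hm' : (0 : ℝ) < m := by positivity
  have hN' : (0 : ℝ) < N := by positivity
  have hσ := stirlingSeq_pos hN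
  have hρ : Stirling.stirlingSeq (2 * m) / Stirling.stirlingSeq m ≠ 0 :=
    (div_pos (stirlingSeq_pos (by omega)) (stirlingSeq_pos hm)).ne'
  have hsqrt : √(2 * Real.pi * N) = √Real.pi * √(2 * N) := by
    rw [← Real.sqrt_mul Real.pi_pos.le]
    congr 1
    ring
  have h₁ : 1 + (m : ℝ) / N = (N + m) / N := by field_simp
  have h₂ : 1 + (N : ℝ) / m = (N + m) / m := by field_simp; ring
  rw [prod_two_mul_add_odd_div, factorial_two_mul_div_factorial hm,
    factorial_two_mul_div_factorial (show N + m ≠ 0 by omega),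
    factorial_eq_stirlingSeq_mul hN, hsqrt, h₁, h₂]
  generalize Stirling.stirlingSeq (2 * m) / Stirling.stirlingSeq m = ρ at *
  generalize Stirling.stirlingSeq (2 * (N + m)) / Stirling.stirlingSeq (N + m) = ρ'
  have : √(2 * (N : ℝ)) ≠ 0 := by positivity
  have : √Real.pi ≠ 0 := (Real.sqrt_pos.2 Real.pi_pos).ne'
  push_cast
  simp only [div_pow, pow_add]
  field_simp

open Filter Topology in
theorem tendsto_prod_div :
    Tendsto (fun p : ℕ × ℕ =>
      (∏ i ∈ Finset.range p.2, (2 * (i : ℝ) + (2 * p.1 + 1 : ℕ)) / (2 * (i : ℝ) + 2)) /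
        ((1 + (p.1 : ℝ) / p.2) ^ p.2 * (1 + (p.2 : ℝ) / p.1) ^ p.1 *
          (√(2 * Real.pi * p.2))⁻¹)) atTop (𝓝 1) := by
  rw [← prod_atTop_atTop_eq]
  have hpi : √Real.pi ≠ 0 := (Real.sqrt_pos.2 Real.pi_pos).ne'
  have hfst : Tendsto (Prod.fst : ℕ × ℕ → ℕ) (atTop ×ˢ atTop) atTop := tendsto_fst
  have hsnd : Tendsto (Prod.snd : ℕ × ℕ → ℕ) (atTop ×ˢ atTop) atTop := tendsto_snd
  have hadd : Tendsto (fun p : ℕ × ℕ => p.2 + p.1) (atTop ×ˢ atTop) atTop :=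
    hsnd.atTop_add_atTop hfst
  have hlim := ((tendsto_stirlingSeq_two_mul_div.comp hadd).div
    (tendsto_stirlingSeq_two_mul_div.comp hfst) one_ne_zero).mul
    ((tendsto_const_nhds (x := √Real.pi)).div
      (Stirling.tendsto_stirlingSeq_sqrt_pi.comp hsnd) hpi)
  rw [div_self one_ne_zero, div_self hpi, one_mul] at hlim
  refine hlim.congr' ?_
  filter_upwards [hfst.eventually_ne_atTop 0, hsnd.eventually_ne_atTop 0] with p h₁ h₂
  exact (prod_div_eq_stirlingSeq h₁ h₂).symm

/-- With `A_{3,N,s} = Π_{i=1}^{N} (2(i−1)+s)/(2i)`, as `s` and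
`N` tend to infinity jointly with `s` odd, the ratio of `A_{3,N,s}` to
`(1 + (s−1)/(2N))^N·(1 + 2N/(s−1))^{(s−1)/2}·(2πN)^{−1/2}` lies within
`[1−ε, 1+ε]`. -/
theorem A3_odd_asymptotics :
    ∀ ε : ℝ, 0 < ε → ∃ M : ℕ, ∀ s N : ℕ, Odd s → M ≤ s → M ≤ N →
      (∏ i ∈ Finset.range N, (2 * (i : ℝ) + s) / (2 * (i : ℝ) + 2)) /
          ((1 + ((s : ℝ) - 1) / (2 * N)) ^ N * (1 + 2 * (N : ℝ) / ((s : ℝ) - 1)) ^ ((s - 1) / 2) *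
            (Real.sqrt (2 * Real.pi * N))⁻¹)
        ∈ Set.Icc (1 - ε) (1 + ε) := by
  intro ε hε
  obtain ⟨a, ha⟩ := Filter.eventually_atTop_prod_self.1
    (tendsto_prod_div.eventually (Icc_mem_nhds (sub_lt_self 1 hε) (lt_add_of_pos_right 1 hε)))
  refine ⟨2 * a + 1, ?_⟩
  rintro s N ⟨m, rfl⟩ hs hN
  have h := ha m N (by omega) (by omega)
  have hcast : ((2 * m + 1 : ℕ) : ℝ) - 1 = 2 * m := by push_cast; ring
  have hdiv : (2 * m + 1 - 1) / 2 = m := by omega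
  rw [hcast, hdiv, mul_div_mul_left _ _ two_ne_zero, mul_div_mul_left _ _ two_ne_zero]
  exact h
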